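/- Let ε, β > 0 and let u be an admissible solution of (★★). Then for every t > 0: ‖u(t,·)‖²_{L²(ℝ)} + β‖∂_x u(t,·)‖²_{L²(ℝ)} + β²‖∂_x² u(t,·)‖²_{L²(ℝ)} + 2ε ∫₀ᵗ ‖∂_x u(s,·)‖²_{L²(ℝ)} ds = ‖u(0,·)‖²_{L²(ℝ)} + β‖∂_x u(0,·)‖²_{L²(ℝ)} + β²‖∂_x² u(0,·)‖²_{L²(ℝ)}. In particular, if this initial quantity is bounded by C₀, then for every t > 0 one also has ‖u(t,·)‖_{L^∞(ℝ)} ≤ (2C₀)^{1/2} β^{−1/4} and ‖∂_x u(t,·)‖_{L^∞(ℝ)} ≤ (2C₀)^{1/2} β^{−3/4}. -/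

import Mathlib

open MeasureTheory Real Filter Set

noncomputable section

/-- `mixedD u j k t x`: `j` time derivatives of the `k`-th spatial derivative of `u` at `(t,x)`. -/
def mixedD (u : ℝ → ℝ → ℝ) (j k : ℕ) (t x : ℝ) : ℝ :=
  iteratedDeriv j (fun s => iteratedDeriv k (fun y => u s y) x) t

/-- Squared `L²` norm in the space variable. -/
def sqL2 (f : ℝ → ℝ) : ℝ := ∫ x : ℝ, (f x) ^ 2

/-- `L²` norm in the space variable. -/
def nL2 (f : ℝ → ℝ) : ℝ := Real.sqrt (∫ x : ℝ, (f x) ^ 2)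

/-- `L⁴` norm in the space variable. -/
def nL4 (f : ℝ → ℝ) : ℝ := (∫ x : ℝ, (f x) ^ 4) ^ ((1 : ℝ) / 4)

/-- Admissible solution of the Rosenau–KdV–RLW approximation (★). -/
structure IsAdmissibleKdVRLW (ε β : ℝ) (u : ℝ → ℝ → ℝ) : Prop where
  smooth : ContDiff ℝ (⊤ : ℕ∞) (fun p : ℝ × ℝ => u p.1 p.2)
  pde : ∀ t > (0 : ℝ), ∀ x : ℝ,
    mixedD u 1 0 t x + deriv (fun y => (u t y) ^ 2) x
      + β * mixedD u 0 3 t x - β * mixedD u 1 2 t x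
      + β ^ 2 * mixedD u 1 4 t x = ε * mixedD u 0 2 t x
  sq_int : ∀ T > (0 : ℝ), ∀ j k : ℕ, j + k ≤ 5 → ∀ t ∈ Set.Icc (0 : ℝ) T,
    MeasureTheory.Integrable (fun x : ℝ => (mixedD u j k t x) ^ 2)
  decay : ∀ T > (0 : ℝ), ∀ j k : ℕ, j + k ≤ 5 → ∀ δ > (0 : ℝ), ∃ M : ℝ,
    ∀ x : ℝ, M ≤ |x| → ∀ t ∈ Set.Icc (0 : ℝ) T, |mixedD u j k t x| ≤ δ

/-- Admissible solution of the Rosenau–RLW approximation (★★). -/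
structure IsAdmissibleRLW (ε β : ℝ) (u : ℝ → ℝ → ℝ) : Prop where
  smooth : ContDiff ℝ (⊤ : ℕ∞) (fun p : ℝ × ℝ => u p.1 p.2)
  pde : ∀ t > (0 : ℝ), ∀ x : ℝ,
    mixedD u 1 0 t x + deriv (fun y => (u t y) ^ 2) x
      - β * mixedD u 1 2 t x + β ^ 2 * mixedD u 1 4 t x = ε * mixedD u 0 2 t x
  sq_int : ∀ T > (0 : ℝ), ∀ j k : ℕ, j + k ≤ 5 → ∀ t ∈ Set.Icc (0 : ℝ) T,
    MeasureTheory.Integrable (fun x : ℝ => (mixedD u j k t x) ^ 2)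
  decay : ∀ T > (0 : ℝ), ∀ j k : ℕ, j + k ≤ 5 → ∀ δ > (0 : ℝ), ∃ M : ℝ,
    ∀ x : ℝ, M ≤ |x| → ∀ t ∈ Set.Icc (0 : ℝ) T, |mixedD u j k t x| ≤ δ

/-- Data bounds with constant `C0` for the (★) approximation. -/
def DataBoundsKdVRLW (ε β C0 : ℝ) (f : ℝ → ℝ) : Prop :=
  (∫ x : ℝ, (f x) ^ 2) + (∫ x : ℝ, (f x) ^ 4)
      + (β + ε ^ 2) * (∫ x : ℝ, (deriv f x) ^ 2) ≤ C0 ∧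
  (β * ε + β * ε ^ 2 + β ^ 2) * (∫ x : ℝ, (iteratedDeriv 2 f x) ^ 2)
      + (β ^ 2 * ε ^ 2 + β ^ 3) * (∫ x : ℝ, (iteratedDeriv 3 f x) ^ 2) ≤ C0 ∧
  β ^ 4 * (∫ x : ℝ, (iteratedDeriv 4 f x) ^ 2) ≤ C0

/-- Data bounds with constant `C0` for the (★★) approximation. -/
def DataBoundsRLW (ε β C0 : ℝ) (f : ℝ → ℝ) : Prop :=
  (∫ x : ℝ, (f x) ^ 2) + (∫ x : ℝ, (f x) ^ 4)
    + β * ε ^ 2 * (∫ x : ℝ, (iteratedDeriv 2 f x) ^ 2) ≤ C0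

/-- `u ∈ L^∞((0,∞); L²(ℝ) ∩ L⁴(ℝ))`. -/
def BddL2L4 (u : ℝ → ℝ → ℝ) : Prop :=
  ∃ M : ℝ, ∀ t > (0 : ℝ), (∫ x : ℝ, (u t x) ^ 2) ≤ M ∧ (∫ x : ℝ, (u t x) ^ 4) ≤ M

/-- Entropy solution of `∂ₜ u + ∂ₓ (u²) = 0` with initial datum `u0`. -/
def IsEntropySolution (u : ℝ → ℝ → ℝ) (u0 : ℝ → ℝ) : Prop :=
  ∀ η : ℝ → ℝ, ContDiff ℝ 2 η → ConvexOn ℝ Set.univ η →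
    (∃ M : ℝ, ∀ v : ℝ, |deriv η v| ≤ M) →
    ∀ φ : ℝ → ℝ → ℝ, ContDiff ℝ (⊤ : ℕ∞) (fun p : ℝ × ℝ => φ p.1 p.2) →
      HasCompactSupport (fun p : ℝ × ℝ => φ p.1 p.2) →
      (∀ t x : ℝ, 0 ≤ φ t x) →
      0 ≤ (∫ t in Set.Ioi (0 : ℝ), ∫ x : ℝ,
            (η (u t x) * deriv (fun s => φ s x) t
              + (∫ ξ in (0 : ℝ)..(u t x), 2 * ξ * deriv η ξ) * deriv (fun y => φ t y) x))
          + ∫ x : ℝ, η (u0 x) * φ 0 x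

lemma hasDerivAt_slice_fst {v : ℝ → ℝ → ℝ} {t x : ℝ}
    (hv : DifferentiableAt ℝ (fun p : ℝ × ℝ => v p.1 p.2) (t, x)) :
    HasDerivAt (fun s => v s x) (fderiv ℝ (fun p : ℝ × ℝ => v p.1 p.2) (t, x) (1, 0)) t :=
  HasFDerivAt.comp_hasDerivAt (f := fun s : ℝ => (s, x)) t hv.hasFDerivAt
    ((hasDerivAt_id t).prodMk (hasDerivAt_const t x))

lemma hasDerivAt_slice_snd {v : ℝ → ℝ → ℝ} {t x : ℝ}
    (hv : DifferentiableAt ℝ (fun p : ℝ × ℝ => v p.1 p.2) (t, x)) :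
    HasDerivAt (v t) (fderiv ℝ (fun p : ℝ × ℝ => v p.1 p.2) (t, x) (0, 1)) x :=
  HasFDerivAt.comp_hasDerivAt (f := fun y : ℝ => (t, y)) x hv.hasFDerivAt
    ((hasDerivAt_const x t).prodMk (hasDerivAt_id x))

lemma contDiff_fderiv_apply_of_smooth {f : ℝ × ℝ → ℝ} (hf : ContDiff ℝ (⊤ : ℕ∞) f)
    (w : ℝ × ℝ) : ContDiff ℝ (⊤ : ℕ∞) (fun p => fderiv ℝ f p w) :=
  (hf.fderiv_right (by norm_cast)).clm_apply contDiff_const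

lemma fderiv_apply_comm_of_smooth {f : ℝ × ℝ → ℝ} (hf : ContDiff ℝ (⊤ : ℕ∞) f)
    (v w p : ℝ × ℝ) :
    fderiv ℝ (fun q => fderiv ℝ f q v) p w = fderiv ℝ (fun q => fderiv ℝ f q w) p v := by
  have h2 : DifferentiableAt ℝ (fderiv ℝ f) p :=
    ((hf.fderiv_right (m := 1) (by norm_cast)).differentiable one_ne_zero) p
  have hs : IsSymmSndFDerivAt ℝ f p :=
    hf.contDiffAt.isSymmSndFDerivAt (by
      rw [minSmoothness_of_isRCLikeNormedField]; norm_cast)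
  rw [fderiv_clm_apply h2 (differentiableAt_const v),
    fderiv_clm_apply h2 (differentiableAt_const w)]
  simpa using hs w v

section MixedDerivatives

variable {u : ℝ → ℝ → ℝ}

lemma mixedD_zero_succ (k : ℕ) (t x : ℝ) :
    mixedD u 0 (k + 1) t x = deriv (mixedD u 0 k t) x := by
  have h : mixedD u 0 k t = iteratedDeriv k (u t) := by
    ext y
    simp only [mixedD, iteratedDeriv_zero]
  rw [h, ← iteratedDeriv_succ]
  simp only [mixedD, iteratedDeriv_zero]

lemma mixedD_one (k : ℕ) (t x : ℝ) :
    mixedD u 1 k t x = deriv (fun s => mixedD u 0 k s x) t := by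
  simp only [mixedD, iteratedDeriv_zero, iteratedDeriv_one]

lemma contDiff_mixedD_zero (hu : ContDiff ℝ (⊤ : ℕ∞) (fun p : ℝ × ℝ => u p.1 p.2)) (k : ℕ) :
    ContDiff ℝ (⊤ : ℕ∞) (fun p : ℝ × ℝ => mixedD u 0 k p.1 p.2) := by
  induction k with
  | zero => simpa [mixedD] using hu
  | succ k ih =>
    convert! contDiff_fderiv_apply_of_smooth ih (0, 1) using 2 with p
    rw [mixedD_zero_succ]
    exact (hasDerivAt_slice_snd (ih.differentiable (by simp) p)).deriv

lemma mixedD_one_eq_fderiv (hu : ContDiff ℝ (⊤ : ℕ∞) (fun p : ℝ × ℝ => u p.1 p.2)) (k : ℕ)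
    (t x : ℝ) :
    mixedD u 1 k t x = fderiv ℝ (fun p : ℝ × ℝ => mixedD u 0 k p.1 p.2) (t, x) (1, 0) := by
  rw [mixedD_one]
  exact (hasDerivAt_slice_fst ((contDiff_mixedD_zero hu k).differentiable (by simp) _)).deriv

lemma contDiff_mixedD_one (hu : ContDiff ℝ (⊤ : ℕ∞) (fun p : ℝ × ℝ => u p.1 p.2)) (k : ℕ) :
    ContDiff ℝ (⊤ : ℕ∞) (fun p : ℝ × ℝ => mixedD u 1 k p.1 p.2) := by
  convert! contDiff_fderiv_apply_of_smooth (contDiff_mixedD_zero hu k) (1, 0) using 2 with p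
  exact mixedD_one_eq_fderiv hu k p.1 p.2

lemma hasDerivAt_mixedD_zero (hu : ContDiff ℝ (⊤ : ℕ∞) (fun p : ℝ × ℝ => u p.1 p.2)) (k : ℕ)
    (t x : ℝ) : HasDerivAt (mixedD u 0 k t) (mixedD u 0 (k + 1) t x) x := by
  rw [mixedD_zero_succ]
  exact (hasDerivAt_slice_snd
    ((contDiff_mixedD_zero hu k).differentiable (by simp) (t, x))).differentiableAt.hasDerivAt

lemma hasDerivAt_mixedD_zero_time (hu : ContDiff ℝ (⊤ : ℕ∞) (fun p : ℝ × ℝ => u p.1 p.2))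
    (k : ℕ) (t x : ℝ) : HasDerivAt (fun s => mixedD u 0 k s x) (mixedD u 1 k t x) t := by
  rw [mixedD_one]
  exact (hasDerivAt_slice_fst
    ((contDiff_mixedD_zero hu k).differentiable (by simp) (t, x))).differentiableAt.hasDerivAt

lemma hasDerivAt_mixedD_one (hu : ContDiff ℝ (⊤ : ℕ∞) (fun p : ℝ × ℝ => u p.1 p.2)) (k : ℕ)
    (t x : ℝ) : HasDerivAt (mixedD u 1 k t) (mixedD u 1 (k + 1) t x) x := by
  have h := hasDerivAt_slice_snd ((contDiff_mixedD_one hu k).differentiable (by simp) (t, x))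
  convert! h using 1
  have hx : (fun p : ℝ × ℝ => mixedD u 0 (k + 1) p.1 p.2) =
      fun p => fderiv ℝ (fun q : ℝ × ℝ => mixedD u 0 k q.1 q.2) p (0, 1) := by
    ext p
    rw [mixedD_zero_succ]
    exact (hasDerivAt_slice_snd ((contDiff_mixedD_zero hu k).differentiable (by simp) _)).deriv
  have ht : (fun p : ℝ × ℝ => mixedD u 1 k p.1 p.2) =
      fun p => fderiv ℝ (fun q : ℝ × ℝ => mixedD u 0 k q.1 q.2) p (1, 0) := by
    ext p
    exact mixedD_one_eq_fderiv hu k p.1 p.2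
  rw [mixedD_one_eq_fderiv hu, hx, ht]
  exact fderiv_apply_comm_of_smooth (contDiff_mixedD_zero hu k) _ _ _

end MixedDerivatives

lemma tendsto_intervalIntegral_zero_of_uniform {F : ℝ → ℝ → ℝ} {T : ℝ} (hT : 0 ≤ T)
    (hF : Tendsto (fun p : ℝ × ℝ => F p.1 p.2) (𝓟 (Icc 0 T) ×ˢ cocompact ℝ) (nhds 0))
    {a : ℕ → ℝ} (ha : Tendsto a atTop (cocompact ℝ)) :
    Tendsto (fun n => ∫ s in (0 : ℝ)..T, F s (a n)) atTop (nhds 0) := by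
  rw [Metric.tendsto_nhds]
  intro δ hδ
  have h := (Metric.tendsto_nhds.mp hF) (δ / (T + 1)) (by positivity)
  rw [eventually_swap_iff, eventually_prod_principal_iff] at h
  filter_upwards [ha.eventually h] with n hn
  rw [dist_zero_right]
  calc ‖∫ s in (0 : ℝ)..T, F s (a n)‖ ≤ δ / (T + 1) * |T - 0| := by
        refine intervalIntegral.norm_integral_le_of_norm_le_const fun s hs => ?_
        rw [uIoc_of_le hT] at hs
        simpa using (hn s (Ioc_subset_Icc_self hs)).le
    _ < δ := by
        rw [sub_zero, abs_of_nonneg hT, div_mul_eq_mul_div, div_lt_iff₀ (by positivity)]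
        nlinarith

/-- Integrated form of the balance law `∂ₜ e + d = ∂ₓ F` on a strip, with dissipation `d ≥ 0`
and a flux `F` that vanishes at spatial infinity. -/
lemma integral_add_integral_dissipation_eq {e F d : ℝ → ℝ → ℝ} {T : ℝ} (hT : 0 ≤ T)
    (he : ContDiff ℝ 1 (fun p : ℝ × ℝ => e p.1 p.2))
    (hF : ContDiff ℝ 1 (fun p : ℝ × ℝ => F p.1 p.2))
    (hd : Continuous (fun p : ℝ × ℝ => d p.1 p.2)) (hd0 : ∀ t x, 0 ≤ d t x)
    (hbal : ∀ t > (0 : ℝ), ∀ x, deriv (fun s => e s x) t + d t x = deriv (F t) x)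
    (hFlim : Tendsto (fun p : ℝ × ℝ => F p.1 p.2) (𝓟 (Icc 0 T) ×ˢ cocompact ℝ) (nhds 0))
    (he0 : Integrable (e 0)) (heT : Integrable (e T)) :
    (∫ x, e T x) + ∫ s in (0 : ℝ)..T, ∫ x, d s x = ∫ x, e 0 x := by
  have hpos : Tendsto (fun n : ℕ => (n : ℝ)) atTop atTop := tendsto_natCast_atTop_atTop
  have hneg : Tendsto (fun n : ℕ => -(n : ℝ)) atTop atBot := tendsto_neg_atTop_atBot.comp hpos
  have hbox (n : ℕ) : ∫ s in (0 : ℝ)..T, ∫ x in (-(n : ℝ))..n, d s x =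
      (∫ s in (0 : ℝ)..T, F s n) - (∫ s in (0 : ℝ)..T, F s (-n))
        + (∫ x in (-(n : ℝ))..n, e 0 x) - ∫ x in (-(n : ℝ))..n, e T x := by
    have hdiv := integral2_divergence_prod_of_hasFDerivAt
      (fun p : ℝ × ℝ => -e p.1 p.2) (fun p : ℝ × ℝ => F p.1 p.2)
      (fun p => -fderiv ℝ (fun p : ℝ × ℝ => e p.1 p.2) p)
      (fun p => fderiv ℝ (fun p : ℝ × ℝ => F p.1 p.2) p) 0 (-n) T n
      he.continuous.neg.continuousOn hF.continuous.continuousOn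
      (fun p _ => (he.differentiable one_ne_zero p).hasFDerivAt.neg)
      (fun p _ => (hF.differentiable one_ne_zero p).hasFDerivAt)
      (ContinuousOn.integrableOn_compact (isCompact_uIcc.prod isCompact_uIcc)
        (((he.continuous_fderiv one_ne_zero).neg.clm_apply continuous_const).add
          ((hF.continuous_fderiv one_ne_zero).clm_apply continuous_const)).continuousOn)
    simp only [intervalIntegral.integral_neg] at hdiv
    rw [show (∫ s in (0 : ℝ)..T, F s n) - (∫ s in (0 : ℝ)..T, F s (-n))
        + (∫ x in (-(n : ℝ))..n, e 0 x) - ∫ x in (-(n : ℝ))..n, e T x =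
        (∫ s in (0 : ℝ)..T, F s n) - (∫ s in (0 : ℝ)..T, F s (-n))
        + -(∫ x in (-(n : ℝ))..n, e T x) - -∫ x in (-(n : ℝ))..n, e 0 x by ring, ← hdiv]
    refine intervalIntegral.integral_congr_ae (ae_of_all _ fun s hs => ?_)
    rw [uIoc_of_le hT] at hs
    refine intervalIntegral.integral_congr fun x _ => ?_
    have hb := hbal s hs.1 x
    rw [(hasDerivAt_slice_fst (he.differentiable one_ne_zero (s, x))).deriv,
      (hasDerivAt_slice_snd (hF.differentiable one_ne_zero (s, x))).deriv] at hb
    simp only [neg_apply]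
    linarith
  have hlim : Tendsto (fun n : ℕ => ∫ s in (0 : ℝ)..T, ∫ x in (-(n : ℝ))..n, d s x) atTop
      (nhds ((∫ x, e 0 x) - ∫ x, e T x)) := by
    simp only [hbox]
    simpa using (((tendsto_intervalIntegral_zero_of_uniform hT hFlim
      (hpos.mono_right atTop_le_cocompact)).sub
      (tendsto_intervalIntegral_zero_of_uniform hT hFlim
      (hneg.mono_right atBot_le_cocompact))).add
      (intervalIntegral_tendsto_integral he0 hneg hpos)).sub
      (intervalIntegral_tendsto_integral heT hneg hpos)
  set μ : Measure ℝ := volume.restrict (Ioc 0 T) with hμ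
  have hcover : AECover (μ.prod (volume : Measure ℝ)) atTop
      (fun n : ℕ => (univ : Set ℝ) ×ˢ Ioc (-(n : ℝ)) n) := by
    refine ⟨ae_of_all _ fun p => ?_, fun n => MeasurableSet.univ.prod measurableSet_Ioc⟩
    filter_upwards [hneg.eventually_lt_atBot p.2, hpos.eventually_ge_atTop p.2] with n h1 h2
    exact ⟨mem_univ _, h1, h2⟩
  have hint (n : ℕ) : IntegrableOn (fun p : ℝ × ℝ => d p.1 p.2)
      ((univ : Set ℝ) ×ˢ Ioc (-(n : ℝ)) n) (μ.prod volume) := by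
    rw [IntegrableOn, ← Measure.prod_restrict, Measure.restrict_univ, hμ, Measure.prod_restrict,
      ← Measure.volume_eq_prod]
    exact (hd.continuousOn.integrableOn_compact (isCompact_Icc.prod isCompact_Icc)).mono_set
      (prod_mono Ioc_subset_Icc_self Ioc_subset_Icc_self)
  have hset (n : ℕ) : ∫ p in (univ : Set ℝ) ×ˢ Ioc (-(n : ℝ)) n, d p.1 p.2 ∂(μ.prod volume) =
      ∫ s in (0 : ℝ)..T, ∫ x in (-(n : ℝ))..n, d s x := by
    rw [setIntegral_prod _ (hint n), Measure.restrict_univ, intervalIntegral.integral_of_le hT]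
    refine integral_congr_ae (ae_of_all _ fun s => ?_)
    exact (intervalIntegral.integral_of_le (by linarith [n.cast_nonneg (α := ℝ)])).symm
  simp only [← hset] at hlim
  have hnn : ∀ᵐ p ∂(μ.prod (volume : Measure ℝ)), 0 ≤ d p.1 p.2 := ae_of_all _ fun p => hd0 _ _
  have hd_int := hcover.integrable_of_integral_tendsto_of_nonneg_ae _ hint hnn hlim
  have hval := hcover.integral_eq_of_tendsto _ hd_int hlim
  rw [integral_prod _ hd_int] at hval
  rw [intervalIntegral.integral_of_le hT]
  simp only at hval
  linarith

/-- The one-dimensional Agmon inequality in additive form. -/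
lemma sq_le_integral_of_one_le_mul {f f' : ℝ → ℝ} {a b : ℝ} (ha : 0 ≤ a) (hb : 0 ≤ b)
    (hab : 1 ≤ a * b) (hf : ∀ x, HasDerivAt f (f' x) x) (hf' : Continuous f')
    (h2 : Integrable (fun x => f x ^ 2)) (h2' : Integrable (fun x => f' x ^ 2))
    (hlim : Tendsto f atBot (nhds 0)) (x : ℝ) :
    f x ^ 2 ≤ a * (∫ y, f y ^ 2) + b * ∫ y, f' y ^ 2 := by
  have hle (y : ℝ) : |2 * f y * f' y| ≤ a * f y ^ 2 + b * f' y ^ 2 := by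
    refine abs_le_of_sq_le_sq ?_ (by positivity)
    nlinarith [sq_nonneg (a * f y ^ 2 - b * f' y ^ 2),
      mul_le_mul_of_nonneg_right hab (by positivity : 0 ≤ f y ^ 2 * f' y ^ 2)]
  have hcf : Continuous f := continuous_iff_continuousAt.2 fun y => (hf y).continuousAt
  have hsum : Integrable (fun y => a * f y ^ 2 + b * f' y ^ 2) :=
    (h2.const_mul a).add (h2'.const_mul b)
  have hprod : Integrable (fun y => 2 * f y * f' y) :=
    hsum.mono' (by fun_prop) (ae_of_all _ hle)
  have hftc := integral_Iic_of_hasDerivAt_of_tendsto' (a := x) (m := 0) (f := fun y => f y ^ 2)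
    (f' := fun y => 2 * f y * f' y)
    (fun y _ => by simpa using (hf y).fun_pow 2) hprod.integrableOn (by simpa using hlim.pow 2)
  calc f x ^ 2 = ∫ y in Iic x, 2 * f y * f' y := by rw [hftc, sub_zero]
    _ ≤ ∫ y in Iic x, (a * f y ^ 2 + b * f' y ^ 2) :=
      integral_mono hprod.integrableOn hsum.integrableOn fun y => (le_abs_self _).trans (hle y)
    _ ≤ ∫ y, (a * f y ^ 2 + b * f' y ^ 2) :=
      setIntegral_le_integral hsum (ae_of_all _ fun y => by positivity)
    _ = _ := by
      rw [integral_add (h2.const_mul a) (h2'.const_mul b), integral_const_mul, integral_const_mul]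

namespace IsAdmissibleRLW

variable {ε β : ℝ} {u : ℝ → ℝ → ℝ}

lemma tendsto_mixedD (hu : IsAdmissibleRLW ε β u) {T : ℝ} (hT : 0 < T) {j k : ℕ}
    (hjk : j + k ≤ 5) :
    Tendsto (fun p : ℝ × ℝ => mixedD u j k p.1 p.2) (𝓟 (Icc 0 T) ×ˢ cocompact ℝ) (nhds 0) := by
  rw [Metric.tendsto_nhds]
  intro δ hδ
  obtain ⟨M, hM⟩ := hu.decay T hT j k hjk (δ / 2) (by positivity)
  have hfar : ∀ᶠ x in cocompact ℝ, M ≤ |x| :=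
    (tendsto_norm_cocompact_atTop (E := ℝ)).eventually_ge_atTop M
  filter_upwards [(eventually_principal.2 fun t ht => ht : ∀ᶠ t in 𝓟 (Icc 0 T),
    t ∈ Icc 0 T).prod_mk hfar] with p hp
  rw [dist_zero_right, Real.norm_eq_abs]
  linarith [hM p.2 hp.2 p.1 hp.1]

/-- The energy identity of the Rosenau–RLW approximation. -/
lemma energy_eq (hu : IsAdmissibleRLW ε β u) (hε : 0 < ε) {t : ℝ} (ht : 0 < t) :
    sqL2 (u t) + β * sqL2 (mixedD u 0 1 t) + β ^ 2 * sqL2 (mixedD u 0 2 t)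
        + 2 * ε * ∫ s in (0 : ℝ)..t, sqL2 (mixedD u 0 1 s)
      = sqL2 (u 0) + β * sqL2 (mixedD u 0 1 0) + β ^ 2 * sqL2 (mixedD u 0 2 0) := by
  have hu0 : mixedD u 0 0 = u := by ext; simp [mixedD]
  have hs0 (k : ℕ) := (contDiff_mixedD_zero hu.smooth k).of_le (m := 1) (by exact_mod_cast le_top)
  have hs1 (k : ℕ) := (contDiff_mixedD_one hu.smooth k).of_le (m := 1) (by exact_mod_cast le_top)
  set e : ℝ → ℝ → ℝ := fun s x => mixedD u 0 0 s x ^ 2 + β * mixedD u 0 1 s x ^ 2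
    + β ^ 2 * mixedD u 0 2 s x ^ 2 with he
  have hi (s : ℝ) (hs : s ∈ Icc 0 t) (k : ℕ) (hk : k ≤ 5) :
      Integrable (fun x => mixedD u 0 k s x ^ 2) := hu.sq_int t ht 0 k (by omega) s hs
  have heint (s : ℝ) (hs : s ∈ Icc 0 t) : Integrable (e s) :=
    ((hi s hs 0 (by norm_num)).add ((hi s hs 1 (by norm_num)).const_mul β)).add
      ((hi s hs 2 (by norm_num)).const_mul (β ^ 2))
  have heval (s : ℝ) (hs : s ∈ Icc 0 t) : ∫ x, e s x =
      sqL2 (u s) + β * sqL2 (mixedD u 0 1 s) + β ^ 2 * sqL2 (mixedD u 0 2 s) := by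
    simp only [he]
    rw [integral_add ((hi s hs 0 (by norm_num)).fun_add ((hi s hs 1 (by norm_num)).const_mul β))
        ((hi s hs 2 (by norm_num)).const_mul (β ^ 2)),
      integral_add (hi s hs 0 (by norm_num)) ((hi s hs 1 (by norm_num)).const_mul β),
      integral_const_mul, integral_const_mul, hu0]
    rfl
  have hmain := integral_add_integral_dissipation_eq (e := e)
    (d := fun s x => 2 * ε * mixedD u 0 1 s x ^ 2)
    (F := fun s x => 2 * ε * (mixedD u 0 0 s x * mixedD u 0 1 s x)
      - 4 / 3 * mixedD u 0 0 s x ^ 3 + 2 * β * (mixedD u 0 0 s x * mixedD u 1 1 s x)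
      - 2 * β ^ 2 * (mixedD u 0 0 s x * mixedD u 1 3 s x - mixedD u 0 1 s x * mixedD u 1 2 s x))
    ht.le ?_ ?_ ?_ (fun s x => by positivity) ?_ ?_
    (heint 0 ⟨le_rfl, ht.le⟩) (heint t ⟨ht.le, le_rfl⟩)
  · rw [heval 0 ⟨le_rfl, ht.le⟩, heval t ⟨ht.le, le_rfl⟩] at hmain
    simpa only [sqL2, integral_const_mul, intervalIntegral.integral_const_mul] using hmain
  · exact (((hs0 0).pow 2).add (contDiff_const.mul ((hs0 1).pow 2))).add
      (contDiff_const.mul ((hs0 2).pow 2))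
  · exact (((contDiff_const.mul ((hs0 0).mul (hs0 1))).sub
      (contDiff_const.mul ((hs0 0).pow 3))).add (contDiff_const.mul ((hs0 0).mul (hs1 1)))).sub
      (contDiff_const.mul (((hs0 0).mul (hs1 3)).sub ((hs0 1).mul (hs1 2))))
  · exact continuous_const.mul ((hs0 1).continuous.pow 2)
  · intro s hs x
    have dt (k : ℕ) := hasDerivAt_mixedD_zero_time hu.smooth k s x
    have dx0 (k : ℕ) := hasDerivAt_mixedD_zero hu.smooth k s x
    have dx1 (k : ℕ) := hasDerivAt_mixedD_one hu.smooth k s x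
    have hpde := hu.pde s hs x
    have hsq := (dx0 0).pow 2
    rw [hu0] at hsq
    have hsq' : deriv (fun y => u s y ^ 2) x = _ := hsq.deriv
    rw [hsq'] at hpde
    have h1 := (((dt 0).pow 2).add (((dt 1).pow 2).const_mul β)).add
      (((dt 2).pow 2).const_mul (β ^ 2))
    have h2 := (((((dx0 0).mul (dx0 1)).const_mul (2 * ε)).sub
      (((dx0 0).pow 3).const_mul (4 / 3))).add
      (((dx0 0).mul (dx1 1)).const_mul (2 * β))).sub
      ((((dx0 0).mul (dx1 3)).sub ((dx0 1).mul (dx1 2))).const_mul (2 * β ^ 2))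
    have h1' : deriv (fun r => e r x) s = _ := h1.deriv
    rw [h1']
    refine Eq.trans ?_ h2.deriv.symm
    rw [hu0]
    norm_num
    linear_combination 2 * u s x * hpde
  · have l0 (k : ℕ) (hk : k ≤ 4) := hu.tendsto_mixedD ht (j := 0) (k := k) (by omega)
    have l1 (k : ℕ) (hk : k ≤ 4) := hu.tendsto_mixedD ht (j := 1) (k := k) (by omega)
    have l00 := l0 0 (by norm_num)
    have l01 := l0 1 (by norm_num)
    simpa using ((((l00.mul l01).const_mul (2 * ε)).sub ((l00.pow 3).const_mul (4 / 3))).add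
      ((l00.mul (l1 1 (by norm_num))).const_mul (2 * β))).sub
      (((l00.mul (l1 3 (by norm_num))).sub (l01.mul (l1 2 (by norm_num)))).const_mul (2 * β ^ 2))

lemma sq_mixedD_le (hu : IsAdmissibleRLW ε β u) {t : ℝ} (ht : 0 < t) {k : ℕ} (hk : k ≤ 4)
    {a b : ℝ} (ha : 0 ≤ a) (hb : 0 ≤ b) (hab : 1 ≤ a * b) (x : ℝ) :
    mixedD u 0 k t x ^ 2 ≤ a * sqL2 (mixedD u 0 k t) + b * sqL2 (mixedD u 0 (k + 1) t) := by
  have hk0 : 0 + k ≤ 5 := by omega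
  have hk1 : 0 + (k + 1) ≤ 5 := by omega
  have htt : t ∈ Icc 0 t := ⟨ht.le, le_rfl⟩
  have hmem : Tendsto (fun _ : ℝ => t) atBot (𝓟 (Icc 0 t)) :=
    tendsto_principal.2 (Eventually.of_forall fun _ => htt)
  have hcoc : Tendsto (fun y : ℝ => y) atBot (cocompact ℝ) :=
    tendsto_id.mono_right atBot_le_cocompact
  have hline : Tendsto (fun y : ℝ => (t, y)) atBot (𝓟 (Icc 0 t) ×ˢ cocompact ℝ) :=
    hmem.prodMk hcoc
  have hcont : Continuous (mixedD u 0 (k + 1) t) :=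
    continuous_iff_continuousAt.2 fun y =>
      (hasDerivAt_mixedD_zero hu.smooth (k + 1) t y).continuousAt
  have hlim : Tendsto (mixedD u 0 k t) atBot (nhds 0) := by
    simpa only [Function.comp_def] using (hu.tendsto_mixedD ht hk0).comp hline
  exact sq_le_integral_of_one_le_mul ha hb hab (hasDerivAt_mixedD_zero hu.smooth k t) hcont
    (hu.sq_int t ht 0 k hk0 t htt) (hu.sq_int t ht 0 (k + 1) hk1 t htt) hlim x

end IsAdmissibleRLW

lemma abs_le_sqrt_two_mul_rpow {y C β r : ℝ} (hβ : 0 < β) (hC : 0 ≤ C)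
    (h : y ^ 2 ≤ β ^ (2 * r) * C) : |y| ≤ √(2 * C) * β ^ r := by
  have hr : (β ^ r) ^ 2 = β ^ (2 * r) := by
    rw [← rpow_natCast, ← rpow_mul hβ.le]; congr 1; push_cast; ring
  refine abs_le_of_sq_le_sq ?_ (by positivity)
  rw [mul_pow, hr, sq_sqrt (by positivity)]
  nlinarith [mul_nonneg (rpow_nonneg hβ.le (2 * r)) hC]

/-- Energy identity and `L^∞` bounds for the Rosenau–RLW approximation (★★). -/
theorem energy_identity_RLW (ε β : ℝ) (hε : 0 < ε) (hβ : 0 < β)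
    (u : ℝ → ℝ → ℝ) (hu : IsAdmissibleRLW ε β u) :
    ∀ t > (0 : ℝ),
      (sqL2 (u t) + β * sqL2 (fun x => mixedD u 0 1 t x)
          + β ^ 2 * sqL2 (fun x => mixedD u 0 2 t x)
          + 2 * ε * ∫ s in (0 : ℝ)..t, sqL2 (fun x => mixedD u 0 1 s x))
        = sqL2 (u 0) + β * sqL2 (fun x => mixedD u 0 1 0 x)
            + β ^ 2 * sqL2 (fun x => mixedD u 0 2 0 x)
      ∧ ∀ C0 : ℝ,
          sqL2 (u 0) + β * sqL2 (fun x => mixedD u 0 1 0 x)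
              + β ^ 2 * sqL2 (fun x => mixedD u 0 2 0 x) ≤ C0 →
          ∀ x : ℝ,
            |u t x| ≤ Real.sqrt (2 * C0) * β ^ (-(1 / 4 : ℝ)) ∧
            |mixedD u 0 1 t x| ≤ Real.sqrt (2 * C0) * β ^ (-(3 / 4 : ℝ)) := by
  intro t ht
  have hE := hu.energy_eq hε ht
  refine ⟨hE, fun C0 hC0 x => ?_⟩
  have hnn (f : ℝ → ℝ) : 0 ≤ sqL2 f := integral_nonneg fun _ => sq_nonneg _
  have hdiss : 0 ≤ 2 * ε * ∫ s in (0 : ℝ)..t, sqL2 (mixedD u 0 1 s) :=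
    mul_nonneg (by positivity)
      (intervalIntegral.integral_nonneg ht.le fun s _ => hnn _)
  have hEt : sqL2 (u t) + β * sqL2 (mixedD u 0 1 t) + β ^ 2 * sqL2 (mixedD u 0 2 t) ≤ C0 := by
    linarith
  have h0 := hnn (u t)
  have h1 : 0 ≤ β * sqL2 (mixedD u 0 1 t) := mul_nonneg hβ.le (hnn _)
  have h2 : 0 ≤ β ^ 2 * sqL2 (mixedD u 0 2 t) := mul_nonneg (sq_nonneg β) (hnn _)
  have hC : 0 ≤ C0 := by linarith
  constructor
  · refine abs_le_sqrt_two_mul_rpow hβ hC ?_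
    set a := β ^ (2 * -(1 / 4 : ℝ)) with ha
    have ha0 : 0 < a := by positivity
    have haa : a * (a * β) = 1 := by
      rw [← mul_assoc, ha, ← rpow_add hβ, ← rpow_add_one hβ.ne']; norm_num
    have hu0 : mixedD u 0 0 = u := by ext; simp [mixedD]
    have h := hu.sq_mixedD_le ht (k := 0) (by norm_num) ha0.le (by positivity) haa.ge x
    rw [hu0] at h
    calc u t x ^ 2 ≤ a * (sqL2 (u t) + β * sqL2 (mixedD u 0 1 t)) := by linarith
      _ ≤ a * C0 := mul_le_mul_of_nonneg_left (by linarith) ha0.le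
  · refine abs_le_sqrt_two_mul_rpow hβ hC ?_
    set a := β ^ (2 * -(3 / 4 : ℝ)) with ha
    have ha0 : 0 < a := by positivity
    have haa : (a * β) * (a * β ^ 2) = 1 := by
      have : a * a * β ^ (3 : ℝ) = 1 := by
        rw [ha, ← rpow_add hβ, ← rpow_add hβ]; norm_num
      rw [← this, show (3 : ℝ) = (3 : ℕ) by norm_num, rpow_natCast]; ring
    have h := hu.sq_mixedD_le ht (k := 1) (by norm_num) (by positivity) (by positivity) haa.ge x
    calc mixedD u 0 1 t x ^ 2
        ≤ a * (β * sqL2 (mixedD u 0 1 t) + β ^ 2 * sqL2 (mixedD u 0 2 t)) := by linarith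
      _ ≤ a * C0 := mul_le_mul_of_nonneg_left (by linarith) ha0.le

end
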